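/- Let A be a downset and let π, σ be permutations. If the direct sum π ⊕ σ is A-critical, then there exist downsets B and C with A = B ⊕ C such that π is B-critical and σ is C-critical. Similarly, if the skew sum π ⊖ σ is A-critical, then there exist downsets B and C with A = B ⊖ C such that π is B-critical and σ is C-critical. -/

import Mathlib

/-- The subsequence of `π` indexed by `S` is increasing. -/
def IsIncOn {n : ℕ} (π : Equiv.Perm (Fin n)) (S : Set (Fin n)) : Prop :=
  ∀ i ∈ S, ∀ j ∈ S, i < j → π i < π j

/-- The subsequence of `π` indexed by `S` is decreasing. -/
def IsDecOn {n : ℕ} (π : Equiv.Perm (Fin n)) (S : Set (Fin n)) : Prop :=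
  ∀ i ∈ S, ∀ j ∈ S, i < j → π j < π i

/-- `π` is `(r,s)`-coverable: its index set can be partitioned into `r` sets
indexing increasing subsequences and `s` sets indexing decreasing subsequences. -/
def Coverable {n : ℕ} (π : Equiv.Perm (Fin n)) (r s : ℕ) : Prop :=
  ∃ c : Fin n → Fin r ⊕ Fin s,
    (∀ a : Fin r, IsIncOn π {i | c i = Sum.inl a}) ∧
    (∀ b : Fin s, IsDecOn π {i | c i = Sum.inr b})

/-- `π` is `k`-coverable: `(r,s)`-coverable for some `r + s = k`. -/
def KCoverable {n : ℕ} (π : Equiv.Perm (Fin n)) (k : ℕ) : Prop :=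
  ∃ r s, r + s = k ∧ Coverable π r s

/-- `τ` is a pattern of `π`. -/
def Pattern {m n : ℕ} (τ : Equiv.Perm (Fin m)) (π : Equiv.Perm (Fin n)) : Prop :=
  ∃ f : Fin m → Fin n, StrictMono f ∧ ∀ i j, τ i < τ j ↔ π (f i) < π (f j)

/-- `τ` is a proper pattern of `π`. -/
def ProperPattern {m n : ℕ} (τ : Equiv.Perm (Fin m)) (π : Equiv.Perm (Fin n)) : Prop :=
  m < n ∧ Pattern τ π

/-- `π` is `(r,s)`-critical. -/
def RSCritical {n : ℕ} (π : Equiv.Perm (Fin n)) (r s : ℕ) : Prop :=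
  ¬ Coverable π r s ∧
    ∀ (m : ℕ) (τ : Equiv.Perm (Fin m)), ProperPattern τ π → Coverable τ r s

/-- `π` is `k`-critical. -/
def KCritical {n : ℕ} (π : Equiv.Perm (Fin n)) (k : ℕ) : Prop :=
  ¬ KCoverable π k ∧
    ∀ (m : ℕ) (τ : Equiv.Perm (Fin m)), ProperPattern τ π → KCoverable τ k

/-- `π` is `(r,s)`-sharp: `(r,s)`-critical and `(0,s+1)`-coverable. -/
def RSSharp {n : ℕ} (π : Equiv.Perm (Fin n)) (r s : ℕ) : Prop :=
  RSCritical π r s ∧ Coverable π 0 (s + 1)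

/-- `D(π)`: the set of pairs `(r,s)` such that `π` is not `(r,s)`-coverable. -/
def DSet {n : ℕ} (π : Equiv.Perm (Fin n)) : Set (ℕ × ℕ) :=
  {p | ¬ Coverable π p.1 p.2}

/-- A downset: a finite, downward-closed subset of `ℕ²`. -/
def IsDownset (A : Set (ℕ × ℕ)) : Prop :=
  A.Finite ∧ ∀ p ∈ A, ∀ q : ℕ × ℕ, q.1 ≤ p.1 → q.2 ≤ p.2 → q ∈ A

/-- `A ⊕ B` for subsets of `ℕ²`. -/
def setOplus (A B : Set (ℕ × ℕ)) : Set (ℕ × ℕ) :=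
  {p | ∀ s₁ s₂ : ℕ, s₁ + s₂ = p.2 → (p.1, s₁) ∈ A ∨ (p.1, s₂) ∈ B}

/-- `A ⊖ B` for subsets of `ℕ²`. -/
def setOminus (A B : Set (ℕ × ℕ)) : Set (ℕ × ℕ) :=
  {p | ∀ r₁ r₂ : ℕ, r₁ + r₂ = p.1 → (r₁, p.2) ∈ A ∨ (r₂, p.2) ∈ B}

/-- `π` is `A`-coverable. -/
def ACoverable {n : ℕ} (π : Equiv.Perm (Fin n)) (A : Set (ℕ × ℕ)) : Prop :=
  ∃ p ∈ A, Coverable π p.1 p.2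

/-- `π` is `A`-critical. -/
def ACritical {n : ℕ} (π : Equiv.Perm (Fin n)) (A : Set (ℕ × ℕ)) : Prop :=
  ¬ ACoverable π A ∧
    ∀ (m : ℕ) (τ : Equiv.Perm (Fin m)), ProperPattern τ π → ACoverable τ A

/-- `π` is `A`-minimal: `A`-critical with `D(π) = A`. -/
def AMinimal {n : ℕ} (π : Equiv.Perm (Fin n)) (A : Set (ℕ × ℕ)) : Prop :=
  ACritical π A ∧ DSet π = A

/-- The triangle `T(k) = {(r,s) : r + s ≤ k}`. -/
def T (k : ℕ) : Set (ℕ × ℕ) := {p | p.1 + p.2 ≤ k}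

/-- Direct sum of permutations: `π` followed by `σ` shifted up by `n`. -/
def directSum {n m : ℕ} (π : Equiv.Perm (Fin n)) (σ : Equiv.Perm (Fin m)) :
    Equiv.Perm (Fin (n + m)) :=
  finSumFinEquiv.symm.trans ((Equiv.sumCongr π σ).trans finSumFinEquiv)

/-- Skew sum of permutations: `π` shifted up by `m`, followed by `σ`. -/
def skewSum {n m : ℕ} (π : Equiv.Perm (Fin n)) (σ : Equiv.Perm (Fin m)) :
    Equiv.Perm (Fin (n + m)) :=
  finSumFinEquiv.symm.trans (((Equiv.sumCongr π σ).trans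
    (Equiv.sumComm (Fin n) (Fin m))).trans
    (finSumFinEquiv.trans (finCongr (Nat.add_comm m n))))

/-- Tensor product of permutations: `n` copies of `σ`, ordered like `π`. -/
def tensorProd {n m : ℕ} (π : Equiv.Perm (Fin n)) (σ : Equiv.Perm (Fin m)) :
    Equiv.Perm (Fin (n * m)) :=
  finProdFinEquiv.symm.trans ((Equiv.prodCongr π σ).trans finProdFinEquiv)

/-! ### Coverings -/

lemma coverable_of_coloring {n r s : ℕ} {α β : Type*} {π : Equiv.Perm (Fin n)}
    (f : α ↪ Fin r) (g : β ↪ Fin s) (c : Fin n → α ⊕ β)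
    (hinc : ∀ i j a, c i = Sum.inl a → c j = Sum.inl a → i < j → π i < π j)
    (hdec : ∀ i j b, c i = Sum.inr b → c j = Sum.inr b → i < j → π j < π i) :
    Coverable π r s := by
  refine ⟨fun i => Sum.map f g (c i), ?_, ?_⟩
  · intro a i hi j hj hij
    simp only [Set.mem_ofPred_eq] at hi hj
    rcases hci : c i with x | x <;> rcases hcj : c j with y | y <;> simp [hci, hcj] at hi hj
    obtain rfl : x = y := f.injective (hi.trans hj.symm)
    exact hinc i j x hci hcj hij
  · intro b i hi j hj hij
    simp only [Set.mem_ofPred_eq] at hi hj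
    rcases hci : c i with x | x <;> rcases hcj : c j with y | y <;> simp [hci, hcj] at hi hj
    obtain rfl : x = y := g.injective (hi.trans hj.symm)
    exact hdec i j x hci hcj hij

lemma Coverable.mono {n r s r' s' : ℕ} {π : Equiv.Perm (Fin n)} (h : Coverable π r s)
    (hr : r ≤ r') (hs : s ≤ s') : Coverable π r' s' := by
  obtain ⟨c, hinc, hdec⟩ := h
  exact coverable_of_coloring (Fin.castLEEmb hr) (Fin.castLEEmb hs) c
    (fun i j a hi hj => hinc a i hi j hj) (fun i j b hi hj => hdec b i hi j hj)

lemma mem_DSet_of_le {n : ℕ} (π : Equiv.Perm (Fin n)) :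
    ∀ p ∈ DSet π, ∀ q : ℕ × ℕ, q.1 ≤ p.1 → q.2 ≤ p.2 → q ∈ DSet π :=
  fun _ hp _ h₁ h₂ hq => hp (hq.mono h₁ h₂)

/-! ### Direct sums -/

lemma sumMap_id_eq_inl_iff {α β γ : Type*} {g : β → γ} {x : α ⊕ β} {a : α} :
    Sum.map id g x = Sum.inl a ↔ x = Sum.inl a := by
  cases x <;> simp

lemma sumMap_eq_inr_iff {α β γ δ : Type*} {f : α → γ} {g : β → δ} {x : α ⊕ β} {d : δ} :
    Sum.map f g x = Sum.inr d ↔ ∃ b, x = Sum.inr b ∧ g b = d := by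
  cases x <;> simp

@[simp] lemma castAdd_lt_castAdd_iff {n : ℕ} (m : ℕ) {i j : Fin n} :
    Fin.castAdd m i < Fin.castAdd m j ↔ i < j :=
  Iff.rfl

@[simp] lemma directSum_castAdd {n m : ℕ} (π : Equiv.Perm (Fin n)) (σ : Equiv.Perm (Fin m))
    (i : Fin n) : directSum π σ (Fin.castAdd m i) = Fin.castAdd m (π i) := by
  simp [directSum]

@[simp] lemma directSum_natAdd {n m : ℕ} (π : Equiv.Perm (Fin n)) (σ : Equiv.Perm (Fin m))
    (i : Fin m) : directSum π σ (Fin.natAdd n i) = Fin.natAdd n (σ i) := by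
  simp [directSum]

lemma Coverable.directSum {n m r s₁ s₂ : ℕ} {π : Equiv.Perm (Fin n)} {σ : Equiv.Perm (Fin m)}
    (hπ : Coverable π r s₁) (hσ : Coverable σ r s₂) :
    Coverable (directSum π σ) r (s₁ + s₂) := by
  obtain ⟨c, hci, hcd⟩ := hπ
  obtain ⟨d, hdi, hdd⟩ := hσ
  refine coverable_of_coloring (α := Fin r) (β := Fin s₁ ⊕ Fin s₂) (Function.Embedding.refl _)
    finSumFinEquiv.toEmbedding
    (Fin.addCases (fun i => Sum.map id Sum.inl (c i)) (fun i => Sum.map id Sum.inr (d i))) ?_ ?_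
  · intro i j a
    induction i using Fin.addCases with
    | left i =>
      induction j using Fin.addCases with
      | left j =>
        intro hi hj hij
        simp only [Fin.addCases_left, sumMap_id_eq_inl_iff] at hi hj
        simpa using hci a i hi j hj (by simpa using hij)
      | right j =>
        intro _ _ _
        simp [Fin.lt_def]
        omega
    | right i =>
      induction j using Fin.addCases with
      | left j =>
        intro _ _ hij
        simp [Fin.lt_def] at hij
        omega
      | right j =>
        intro hi hj hij
        simp only [Fin.addCases_right, sumMap_id_eq_inl_iff] at hi hj
        simpa using hdi a i hi j hj (by simpa using hij)
  · intro i j b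
    induction i using Fin.addCases with
    | left i =>
      induction j using Fin.addCases with
      | left j =>
        intro hi hj hij
        simp only [Fin.addCases_left, sumMap_eq_inr_iff] at hi hj
        obtain ⟨x, hx, rfl⟩ := hi
        obtain ⟨y, hy, hxy⟩ := hj
        obtain rfl := Sum.inl_injective hxy
        simpa using hcd y i hx j hy (by simpa using hij)
      | right j =>
        intro hi hj
        simp only [Fin.addCases_left, Fin.addCases_right, sumMap_eq_inr_iff] at hi hj
        obtain ⟨x, hx, rfl⟩ := hi
        obtain ⟨y, hy, hxy⟩ := hj
        simp at hxy
    | right i =>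
      induction j using Fin.addCases with
      | left j =>
        intro _ _ hij
        simp [Fin.lt_def] at hij
        omega
      | right j =>
        intro hi hj hij
        simp only [Fin.addCases_right, sumMap_eq_inr_iff] at hi hj
        obtain ⟨x, hx, rfl⟩ := hi
        obtain ⟨y, hy, hxy⟩ := hj
        obtain rfl := Sum.inr_injective hxy
        simpa using hdd y i hx j hy (by simpa using hij)

/-- A coloring whose decreasing colors all lie in `P` needs only `P.card` of them. -/
lemma coverable_of_forall_mem {n r s k : ℕ} {π : Equiv.Perm (Fin n)} (P : Finset (Fin s))
    (hP : P.card = k) (c : Fin n → Fin r ⊕ Fin s) (hc : ∀ i b, c i = Sum.inr b → b ∈ P)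
    (hinc : ∀ i j a, c i = Sum.inl a → c j = Sum.inl a → i < j → π i < π j)
    (hdec : ∀ i j b, c i = Sum.inr b → c j = Sum.inr b → i < j → π j < π i) :
    Coverable π r k := by
  have key : ∀ i, ∃ x : Fin r ⊕ P, Sum.map id Subtype.val x = c i := by
    intro i
    rcases h : c i with a | b
    · exact ⟨Sum.inl a, rfl⟩
    · exact ⟨Sum.inr ⟨b, hc i b h⟩, rfl⟩
  choose d hd using key
  refine coverable_of_coloring (Function.Embedding.refl _) (P.equivFinOfCardEq hP).toEmbedding d
    (fun i j a hi hj => hinc i j a ?_ ?_) (fun i j b hi hj => hdec i j b ?_ ?_)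
  · rw [← hd, hi]; rfl
  · rw [← hd, hj]; rfl
  · rw [← hd, hi]; rfl
  · rw [← hd, hj]; rfl

lemma Coverable.exists_of_directSum {n m r s : ℕ} {π : Equiv.Perm (Fin n)}
    {σ : Equiv.Perm (Fin m)} (h : Coverable (_root_.directSum π σ) r s) :
    ∃ s₁ s₂, s₁ + s₂ = s ∧ Coverable π r s₁ ∧ Coverable σ r s₂ := by
  classical
  obtain ⟨c, hinc, hdec⟩ := h
  let P : Finset (Fin s) := {b | ∃ i : Fin n, c (Fin.castAdd m i) = Sum.inr b}
  refine ⟨P.card, Pᶜ.card, by simp, ?_, ?_⟩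
  · refine coverable_of_forall_mem P rfl (fun i => c (Fin.castAdd m i)) ?_ ?_ ?_
    · intro i b hi
      simpa [P] using ⟨i, hi⟩
    · intro i j a hi hj hij
      simpa using hinc a _ hi _ hj (by simpa using hij)
    · intro i j b hi hj hij
      simpa using hdec b _ hi _ hj (by simpa using hij)
  · refine coverable_of_forall_mem Pᶜ rfl (fun i => c (Fin.natAdd n i)) ?_ ?_ ?_
    · intro j b hj
      simp only [P, Finset.mem_compl, Finset.mem_filter, Finset.mem_univ, true_and]
      rintro ⟨i, hi⟩
      have := hdec b _ hi _ hj (by simp [Fin.lt_def]; omega)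
      simp [Fin.lt_def] at this
      omega
    · intro i j a hi hj hij
      simpa using hinc a _ hi _ hj (by simpa using hij)
    · intro i j b hi hj hij
      simpa using hdec b _ hi _ hj (by simpa using hij)

lemma Pattern.refl {n : ℕ} (π : Equiv.Perm (Fin n)) : Pattern π π :=
  ⟨id, strictMono_id, fun _ _ => Iff.rfl⟩

lemma Pattern.directSum {k l n m : ℕ} {τ : Equiv.Perm (Fin k)} {υ : Equiv.Perm (Fin l)}
    {π : Equiv.Perm (Fin n)} {σ : Equiv.Perm (Fin m)} (h₁ : Pattern τ π) (h₂ : Pattern υ σ) :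
    Pattern (directSum τ υ) (directSum π σ) := by
  obtain ⟨f, hf, hfτ⟩ := h₁
  obtain ⟨g, hg, hgυ⟩ := h₂
  refine ⟨Fin.addCases (fun i => Fin.castAdd m (f i)) (fun i => Fin.natAdd n (g i)), ?_, ?_⟩
  · intro i j
    induction i using Fin.addCases with
    | left i =>
      induction j using Fin.addCases with
      | left j => simpa using @hf i j
      | right j =>
        intro _
        simp [Fin.lt_def]
        omega
    | right i =>
      induction j using Fin.addCases with
      | left j =>
        intro hij
        simp [Fin.lt_def] at hij
        omega
      | right j => simpa using @hg i j
  · intro i j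
    induction i using Fin.addCases with
    | left i =>
      induction j using Fin.addCases with
      | left j => simpa using hfτ i j
      | right j =>
        simp [Fin.lt_def]
        omega
    | right i =>
      induction j using Fin.addCases with
      | left j =>
        simp [Fin.lt_def]
        omega
      | right j => simpa using hgυ i j

/-! ### Splitting a downset -/

lemma exists_setOplus_eq {A D E : Set (ℕ × ℕ)} (hA : IsDownset A)
    (hD : ∀ p ∈ D, ∀ q : ℕ × ℕ, q.1 ≤ p.1 → q.2 ≤ p.2 → q ∈ D)
    (hE : ∀ p ∈ E, ∀ q : ℕ × ℕ, q.1 ≤ p.1 → q.2 ≤ p.2 → q ∈ E)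
    (h : A ⊆ setOplus D E) :
    ∃ B C, IsDownset B ∧ IsDownset C ∧ A = setOplus B C ∧ B ⊆ D ∧ C ⊆ E := by
  classical
  obtain ⟨hfin, hdown⟩ := hA
  let C : Set (ℕ × ℕ) := {p | ∃ r t, p.1 ≤ r ∧ (r, t) ∉ D ∧ (r, p.2 + t) ∈ A}
  let B : Set (ℕ × ℕ) := {p | ∃ t, (p.1, t) ∉ C ∧ (p.1, p.2 + t) ∈ A}
  have hCA : C ⊆ A := fun p ⟨r, t, hr, _, ht⟩ => hdown _ ht p hr (Nat.le_add_right _ _)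
  have hBA : B ⊆ A := fun p ⟨t, _, ht⟩ => hdown _ ht p le_rfl (Nat.le_add_right _ _)
  have hCdown : ∀ p ∈ C, ∀ q : ℕ × ℕ, q.1 ≤ p.1 → q.2 ≤ p.2 → q ∈ C :=
    fun p ⟨r, t, hr, htD, htA⟩ q h₁ h₂ =>
      ⟨r, t, h₁.trans hr, htD, hdown _ htA _ le_rfl (Nat.add_le_add_right h₂ t)⟩
  have hCE : C ⊆ E := by
    rintro p ⟨r, t, hr, htD, htA⟩
    exact hE _ ((h htA t p.2 (Nat.add_comm _ _)).resolve_left htD) p hr le_rfl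
  have hBD : B ⊆ D := by
    rintro p ⟨t, htC, htA⟩
    by_contra hp
    exact htC ⟨p.1, p.2, le_rfl, hp, by rwa [Nat.add_comm]⟩
  have hex : ∀ r, ∃ t, (r, t) ∉ C := by
    intro r
    by_contra! hr
    exact Set.infinite_of_injective_forall_mem (Prod.mk_right_injective r) hr (hfin.subset hCA)
  -- the height of `C` above `r`
  have hheight : ∀ r, ∃ c, (r, c) ∉ C ∧ ∀ t < c, (r, t) ∈ C := fun r =>
    ⟨Nat.find (hex r), Nat.find_spec (hex r), fun t ht => by simpa using Nat.find_min (hex r) ht⟩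
  refine ⟨B, C, ⟨hfin.subset hBA, ?_⟩, ⟨hfin.subset hCA, hCdown⟩, ?_, hBD, hCE⟩
  · rintro ⟨r, s⟩ hp ⟨r', s'⟩ hr hs
    have hsD := hBD hp
    obtain ⟨t, htC, htA⟩ := hp
    simp only at hr hs htC htA
    obtain ⟨c, hcC, hc⟩ := hheight r'
    refine ⟨c, hcC, ?_⟩
    rcases le_or_gt c t with hct | htc
    · exact hdown _ htA _ hr (by simp only; omega)
    · obtain ⟨u, v, hu, hvD, hvA⟩ := hc (c - 1) (by omega)
      simp only at hu hvA
      have hur : u < r := by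
        by_contra! hru
        exact htC ⟨u, v, hru, hvD, hdown _ hvA _ le_rfl (by simp only; omega)⟩
      have hsv : s < v := by
        by_contra! hvs
        exact hvD (hD _ hsD _ hur.le hvs)
      exact hdown _ hvA _ hu (by simp only; omega)
  · ext ⟨r, s⟩
    constructor
    · rintro hA s₁ s₂ rfl
      by_cases hC : (r, s₂) ∈ C
      · exact Or.inr hC
      · exact Or.inl ⟨s₂, hC, hA⟩
    · intro hBC
      obtain ⟨c, hcC, hc⟩ := hheight r
      rcases lt_or_ge s c with hsc | hcs
      · exact hCA (hc s hsc)
      · obtain ⟨t, htC, htA⟩ := (hBC (s - c) c (Nat.sub_add_cancel hcs)).resolve_right hcC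
        have hct : c ≤ t := by
          by_contra! htc
          exact htC (hc t htc)
        exact hdown _ htA _ le_rfl (by simp only; omega)

lemma ACritical.exists_setOplus {n m : ℕ} {A : Set (ℕ × ℕ)} (hA : IsDownset A)
    {π : Equiv.Perm (Fin n)} {σ : Equiv.Perm (Fin m)} (h : ACritical (directSum π σ) A) :
    ∃ B C : Set (ℕ × ℕ), IsDownset B ∧ IsDownset C ∧ A = setOplus B C ∧
      ACritical π B ∧ ACritical σ C := by
  obtain ⟨hncov, hcrit⟩ := h
  have hsub : A ⊆ setOplus (DSet π) (DSet σ) := by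
    rintro ⟨r, s⟩ hp s₁ s₂ rfl
    by_contra! hcov
    simp only [DSet, Set.mem_ofPred_eq, not_not] at hcov
    exact hncov ⟨_, hp, hcov.1.directSum hcov.2⟩
  obtain ⟨B, C, hB, hC, rfl, hBD, hCD⟩ :=
    exists_setOplus_eq hA (mem_DSet_of_le π) (mem_DSet_of_le σ) hsub
  refine ⟨B, C, hB, hC, rfl, ⟨fun ⟨p, hp, hcov⟩ => hBD hp hcov, fun k τ hτ => ?_⟩,
    ⟨fun ⟨p, hp, hcov⟩ => hCD hp hcov, fun k τ hτ => ?_⟩⟩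
  · obtain ⟨p, hp, hcov⟩ := hcrit _ (directSum τ σ)
      ⟨Nat.add_lt_add_right hτ.1 m, hτ.2.directSum (Pattern.refl σ)⟩
    obtain ⟨s₁, s₂, hs, h₁, h₂⟩ := hcov.exists_of_directSum
    exact ⟨_, (hp s₁ s₂ hs).resolve_right fun hmem => hCD hmem h₂, h₁⟩
  · obtain ⟨p, hp, hcov⟩ := hcrit _ (directSum π τ)
      ⟨Nat.add_lt_add_left hτ.1 n, (Pattern.refl π).directSum hτ.2⟩
    obtain ⟨s₁, s₂, hs, h₁, h₂⟩ := hcov.exists_of_directSum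
    exact ⟨_, (hp s₁ s₂ hs).resolve_left fun hmem => hBD hmem h₁, h₂⟩

/-! ### Complements, which exchange direct sums and skew sums -/

/-- The complement of `π`: its values in reversed order. -/
def permCompl {n : ℕ} (π : Equiv.Perm (Fin n)) : Equiv.Perm (Fin n) :=
  π.trans Fin.revPerm

@[simp] lemma permCompl_apply {n : ℕ} (π : Equiv.Perm (Fin n)) (i : Fin n) :
    permCompl π i = (π i).rev := rfl

@[simp] lemma permCompl_permCompl {n : ℕ} (π : Equiv.Perm (Fin n)) :
    permCompl (permCompl π) = π := by
  ext i
  simp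

lemma Coverable.permCompl {n r s : ℕ} {π : Equiv.Perm (Fin n)} (h : Coverable π r s) :
    Coverable (permCompl π) s r := by
  obtain ⟨c, hinc, hdec⟩ := h
  refine ⟨fun i => (c i).swap, fun a i hi j hj hij => ?_, fun b i hi j hj hij => ?_⟩
  · simpa using hdec a i (Sum.swap_leftInverse.injective hi) j
      (Sum.swap_leftInverse.injective hj) hij
  · simpa using hinc b i (Sum.swap_leftInverse.injective hi) j
      (Sum.swap_leftInverse.injective hj) hij

lemma ACoverable.permCompl {n : ℕ} {π : Equiv.Perm (Fin n)} {A : Set (ℕ × ℕ)}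
    (h : ACoverable π A) : ACoverable (permCompl π) (Prod.swap ⁻¹' A) := by
  obtain ⟨p, hp, hcov⟩ := h
  exact ⟨p.swap, by simpa using hp, hcov.permCompl⟩

lemma ProperPattern.permCompl {k n : ℕ} {τ : Equiv.Perm (Fin k)} {π : Equiv.Perm (Fin n)}
    (h : ProperPattern τ π) : ProperPattern (permCompl τ) (permCompl π) := by
  obtain ⟨hlt, f, hf, hfτ⟩ := h
  exact ⟨hlt, f, hf, fun i j => by simpa using hfτ j i⟩

lemma ACritical.permCompl {n : ℕ} {π : Equiv.Perm (Fin n)} {A : Set (ℕ × ℕ)}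
    (h : ACritical π A) : ACritical (permCompl π) (Prod.swap ⁻¹' A) := by
  refine ⟨fun hcov => h.1 ?_, fun k τ hτ => ?_⟩
  · simpa [← Set.preimage_comp] using hcov.permCompl
  · have := (h.2 k (_root_.permCompl τ) (by simpa using hτ.permCompl)).permCompl
    simpa using this

lemma IsDownset.preimage_swap {A : Set (ℕ × ℕ)} (hA : IsDownset A) :
    IsDownset (Prod.swap ⁻¹' A) :=
  ⟨hA.1.preimage Prod.swap_injective.injOn, fun p hp q h₁ h₂ => hA.2 p.swap hp q.swap h₂ h₁⟩

lemma permCompl_skewSum {n m : ℕ} (π : Equiv.Perm (Fin n)) (σ : Equiv.Perm (Fin m)) :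
    permCompl (skewSum π σ) = directSum (permCompl π) (permCompl σ) := by
  ext i
  induction i using Fin.addCases with
  | left i =>
    simp [skewSum, Fin.val_rev]
    omega
  | right i =>
    simp [skewSum, Fin.val_rev]
    omega

/-- Lemma 12: a critical direct (skew) sum decomposes the downset accordingly. -/
theorem critical_sum_decomposition {n m : ℕ} (A : Set (ℕ × ℕ)) (hA : IsDownset A)
    (π : Equiv.Perm (Fin n)) (σ : Equiv.Perm (Fin m)) :
    (ACritical (directSum π σ) A →
      ∃ B C : Set (ℕ × ℕ), IsDownset B ∧ IsDownset C ∧ A = setOplus B C ∧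
        ACritical π B ∧ ACritical σ C) ∧
    (ACritical (skewSum π σ) A →
      ∃ B C : Set (ℕ × ℕ), IsDownset B ∧ IsDownset C ∧ A = setOminus B C ∧
        ACritical π B ∧ ACritical σ C) := by
  refine ⟨ACritical.exists_setOplus hA, fun h => ?_⟩
  have hcompl := h.permCompl
  rw [permCompl_skewSum] at hcompl
  obtain ⟨B, C, hB, hC, hBC, hπ, hσ⟩ := hcompl.exists_setOplus hA.preimage_swap
  refine ⟨Prod.swap ⁻¹' B, Prod.swap ⁻¹' C, hB.preimage_swap, hC.preimage_swap, ?_,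
    by simpa using hπ.permCompl, by simpa using hσ.permCompl⟩
  ext p
  exact Set.ext_iff.mp hBC p.swap
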